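/- Let (V, {f_{il}}) be a weak lower perfect space over k with a lower perfect basis B, let i = ((i_k,l_k))_{k≥1} be a good index sequence, and let a be a good sequence of non-negative integers with a_k = 0 for all k ≥ r+1. Then, with f_{i,a} = f_{i_1l_1}^{a_1}⋯f_{i_rl_r}^{a_r}, one has k^×·p_{i,a}(B_{i,a}) = k^×·(p_{i,a}(f_{i,a}(B_H)) \ {0}), where k^×·S denotes {a·u : a ∈ k^×, u ∈ S}. -/

import Mathlib

open Function

/-- A weak lower perfect space: a `P`-graded `k`-vector space `V = ⊕_{μ ∈ P} V_μ`
with endomorphisms `f il` for `(i,l) ∈ I^∞ = I × ℤ_{>0}`. -/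
structure WeakLowerPerfectSpace (k I P V : Type*) [Field k] [AddCommGroup P]
    [AddCommGroup V] [Module k V] where
  /-- the simple roots `α_i` -/
  alpha : I → P
  alpha_indep : LinearIndependent ℤ alpha
  /-- `P` is a free abelian group -/
  free : Module.Free ℤ P
  /-- the weight spaces `V_μ` -/
  weight : P → Submodule k V
  weight_indep : iSupIndep weight
  weight_sup : ⨆ μ : P, weight μ = ⊤
  /-- the endomorphisms `f_{il}` -/
  f : I × ℕ+ → Module.End k V
  finiteDim : ∀ μ : P, Module.Finite k (weight μ)
  support_bounded : ∃ s : Finset P, ∀ μ : P, weight μ ≠ ⊥ →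
    ∃ lam ∈ s, lam - μ ∈ AddSubmonoid.closure (Set.range alpha)
  f_weight : ∀ (i : I) (l : ℕ+) (μ : P),
    (weight μ).map (f (i, l)) ≤ weight (μ - (l : ℕ) • alpha i)

namespace WeakLowerPerfectSpace

variable {k I P V : Type*} [Field k] [AddCommGroup P] [AddCommGroup V] [Module k V]

/-- `d il v` is the unique `n` with `v ∈ f_{il}^n V \ f_{il}^{n+1} V` (for `v ≠ 0`),
realized as the largest `n` with `v ∈ f_{il}^n V`. -/
noncomputable def d (S : WeakLowerPerfectSpace k I P V) (il : I × ℕ+) (v : V) : ℕ :=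
  sSup {n : ℕ | v ∈ LinearMap.range (S.f il ^ n)}

end WeakLowerPerfectSpace

/-- A lower perfect basis `B` of a weak lower perfect space, with structure maps
`F il : B → B ∪ {0}` (extended by `F il 0 = 0`). -/
structure LowerPerfectBasis {k I P V : Type*} [Field k] [AddCommGroup P]
    [AddCommGroup V] [Module k V] (S : WeakLowerPerfectSpace k I P V) (B : Set V) where
  indep : LinearIndependent k (fun b : B => (b : V))
  spans : Submodule.span k B = ⊤
  graded : ∀ b ∈ B, ∃ μ : P, b ∈ S.weight μ
  /-- the structure map `𝐟_{il}` -/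
  F : I × ℕ+ → V → V
  F_zero : ∀ il : I × ℕ+, F il 0 = 0
  F_mem : ∀ il : I × ℕ+, ∀ b ∈ B, F il b ∈ B ∪ {0}
  F_approx : ∀ il : I × ℕ+, ∀ b ∈ B, ∃ c : kˣ,
    S.f il b - (c : k) • F il b ∈ LinearMap.range (S.f il ^ (S.d il b + 2))
  F_inj : ∀ b ∈ B, ∀ b' ∈ B, (∀ il : I × ℕ+, F il b = F il b') → b = b'

namespace WeakLowerPerfectSpace

variable {k I P V : Type*} [Field k] [AddCommGroup P] [AddCommGroup V] [Module k V]

/-- The subspace `Σ_{(i,l) ∈ I^∞} f_{il} V`. -/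
noncomputable def rad (S : WeakLowerPerfectSpace k I P V) : Submodule k V :=
  ⨆ il : I × ℕ+, LinearMap.range (S.f il)

/-- The highest core `B_H = {b ∈ B | d_{il}(b) = 0 for all (i,l) ∈ I^∞}`. -/
def highestCore (S : WeakLowerPerfectSpace k I P V) (B : Set V) : Set V :=
  {b | b ∈ B ∧ ∀ il : I × ℕ+, S.d il b = 0}

end WeakLowerPerfectSpace

/-- Iterated application `𝐟_{i_1 l_1}^{a_1} ⋯ 𝐟_{i_r l_r}^{a_r}(b)` (rightmost factor applied
first): `fComp F seq a r b = F_{seq 0}^{a 0} (⋯ (F_{seq (r-1)}^{a (r-1)} b))`. -/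
def fComp {V ι : Type*} (F : ι → V → V) (seq : ℕ → ι) (a : ℕ → ℕ) : ℕ → V → V
  | 0, v => v
  | m + 1, v => fComp F seq a m ((F (seq m))^[a m] v)

/-- Iterated application `𝐞_{i_r l_r}^{a_r} ⋯ 𝐞_{i_1 l_1}^{a_1}(b)` (leftmost index applied
first): `eComp E seq a r b = E_{seq (r-1)}^{a (r-1)} (⋯ (E_{seq 0}^{a 0} b))`. -/
def eComp {V ι : Type*} (E : ι → V → V) (seq : ℕ → ι) (a : ℕ → ℕ) : ℕ → V → V
  | 0, v => v
  | m + 1, v => (E (seq m))^[a m] (eComp E seq a m v)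

/-- The sequence `b_0 = b`, `b_{k+1} = 𝐞_{i_{k+1} l_{k+1}}^{d_{i_{k+1} l_{k+1}}(b_k)}(b_k)`. -/
def bseq {V ι : Type*} (E : ι → V → V) (d : ι → V → ℕ) (seq : ℕ → ι) (b : V) : ℕ → V
  | 0 => b
  | m + 1 => (E (seq m))^[d (seq m) (bseq E d seq b m)] (bseq E d seq b m)

/-- The lexicographic strict order on sequences of non-negative integers. -/
def SeqLt (a a' : ℕ → ℕ) : Prop :=
  ∃ m : ℕ, (∀ s < m, a s = a' s) ∧ a m < a' m

/-- The lexicographic order on sequences of non-negative integers. -/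
def SeqLe (a a' : ℕ → ℕ) : Prop := a = a' ∨ SeqLt a a'

namespace WeakLowerPerfectSpace

variable {k I P V : Type*} [Field k] [AddCommGroup P] [AddCommGroup V] [Module k V]

/-- The composite `f_{i_1 l_1}^{a_1} ⋯ f_{i_m l_m}^{a_m}` (as an endomorphism, the
rightmost factor acting first). -/
noncomputable def pprod (S : WeakLowerPerfectSpace k I P V) (seq : ℕ → I × ℕ+)
    (a : ℕ → ℕ) (m : ℕ) : Module.End k V :=
  ((List.range m).map fun j => S.f (seq j) ^ a j).prod

/-- The subspace `V^{>i,a} = Σ_{k=1}^r f_{i_1l_1}^{a_1}⋯f_{i_{k−1}l_{k−1}}^{a_{k−1}} f_{i_kl_k}^{a_k+1} V`. -/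
noncomputable def Vgt (S : WeakLowerPerfectSpace k I P V) (seq : ℕ → I × ℕ+)
    (a : ℕ → ℕ) (r : ℕ) : Submodule k V :=
  ⨆ m : Fin r, LinearMap.range (S.pprod seq a (m : ℕ) * S.f (seq (m : ℕ)) ^ (a (m : ℕ) + 1))

/-- The subspace `V^{≥i,a} = V^{>i,a} + f_{i_1l_1}^{a_1}⋯f_{i_rl_r}^{a_r} V`. -/
noncomputable def Vge (S : WeakLowerPerfectSpace k I P V) (seq : ℕ → I × ℕ+)
    (a : ℕ → ℕ) (r : ℕ) : Submodule k V :=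
  S.Vgt seq a r ⊔ LinearMap.range (S.pprod seq a r)

end WeakLowerPerfectSpace

theorem bseq_succ {V ι : Type*} (E : ι → V → V) (d : ι → V → ℕ) (seq : ℕ → ι) (b : V) (m : ℕ) :
    bseq E d seq b (m + 1) =
      bseq E d (fun j => seq (j + 1)) ((E (seq 0))^[d (seq 0) b] b) m := by
  induction m with
  | zero => rfl
  | succ m ih => rw [bseq, ih, bseq]

namespace WeakLowerPerfectSpace

variable {k I P V : Type*} [Field k] [AddCommGroup P] [AddCommGroup V] [Module k V]

theorem eventually_sub_notMem_closure (S : WeakLowerPerfectSpace k I P V) (x : P) (i : I)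
    (l : ℕ+) : ∀ᶠ n : ℕ in Filter.atTop,
      x - (n * (l : ℕ)) • S.alpha i ∉ AddSubmonoid.closure (Set.range S.alpha) := by
  classical
  have key : ∀ y ∈ AddSubmonoid.closure (Set.range S.alpha),
      ∃ m : I →₀ ℤ, (∀ j, 0 ≤ m j) ∧ Finsupp.linearCombination ℤ S.alpha m = y := by
    intro y hy
    induction hy using AddSubmonoid.closure_induction with
    | mem y hy =>
      obtain ⟨j, rfl⟩ := hy
      refine ⟨Finsupp.single j 1, fun j' => ?_, by simp⟩
      rw [Finsupp.single_apply]
      split_ifs <;> simp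
    | zero => exact ⟨0, by simp, by simp⟩
    | add y z _ _ hy hz =>
      obtain ⟨m, hm, rfl⟩ := hy
      obtain ⟨m', hm', rfl⟩ := hz
      exact ⟨m + m', fun j => by simpa using add_nonneg (hm j) (hm' j), by simp⟩
  by_cases hx : ∃ c : I →₀ ℤ, Finsupp.linearCombination ℤ S.alpha c = x
  · obtain ⟨c, rfl⟩ := hx
    filter_upwards [Filter.eventually_gt_atTop (c i).toNat] with n hn hmem
    obtain ⟨m, hm, h⟩ := key _ hmem
    have h2 : m + Finsupp.single i ((n * (l : ℕ) : ℕ) : ℤ) = c := by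
      apply S.alpha_indep
      rw [map_add, h, Finsupp.linearCombination_single, natCast_zsmul]
      abel
    have h3 := DFunLike.congr_fun h2 i
    simp only [Finsupp.add_apply, Finsupp.single_eq_same] at h3
    have h4 : n ≤ n * (l : ℕ) := Nat.le_mul_of_pos_right _ l.pos
    have h5 := hm i
    omega
  · refine Filter.Eventually.of_forall fun n hmem => hx ?_
    obtain ⟨m, -, h⟩ := key _ hmem
    refine ⟨m + Finsupp.single i ((n * (l : ℕ) : ℕ) : ℤ), ?_⟩
    rw [map_add, h, Finsupp.linearCombination_single, natCast_zsmul]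
    abel

theorem eventually_weight_eq_bot (S : WeakLowerPerfectSpace k I P V) (ν : P) (i : I)
    (l : ℕ+) : ∀ᶠ n : ℕ in Filter.atTop, S.weight (ν + (n * (l : ℕ)) • S.alpha i) = ⊥ := by
  obtain ⟨s, hs⟩ := S.support_bounded
  have h : ∀ᶠ n : ℕ in Filter.atTop, ∀ lam ∈ s, lam - ν - (n * (l : ℕ)) • S.alpha i ∉
      AddSubmonoid.closure (Set.range S.alpha) :=
    (Filter.eventually_all_finset s).2 fun lam _ => S.eventually_sub_notMem_closure (lam - ν) i l
  filter_upwards [h] with n hn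
  by_contra hne
  obtain ⟨lam, hlam, hmem⟩ := hs _ hne
  exact hn lam hlam (by rwa [sub_sub])

theorem pow_mem_weight (S : WeakLowerPerfectSpace k I P V) (i : I) (l : ℕ+) {μ : P} {v : V}
    (hv : v ∈ S.weight μ) (n : ℕ) :
    (S.f (i, l) ^ n) v ∈ S.weight (μ - (n * (l : ℕ)) • S.alpha i) := by
  induction n with
  | zero => simpa using hv
  | succ n ih =>
    rw [pow_succ']
    have := S.f_weight i l _ (Submodule.mem_map_of_mem ih)
    rwa [sub_sub, ← add_smul, ← Nat.succ_mul] at this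

theorem range_pow_anti (S : WeakLowerPerfectSpace k I P V) (il : I × ℕ+) {m n : ℕ}
    (h : m ≤ n) : LinearMap.range (S.f il ^ n) ≤ LinearMap.range (S.f il ^ m) := by
  rintro _ ⟨v, rfl⟩
  exact ⟨(S.f il ^ (n - m)) v, by rw [← Module.End.mul_apply, ← pow_add, Nat.add_sub_of_le h]⟩

theorem pow_mem_range_pow_add (S : WeakLowerPerfectSpace k I P V) (il : I × ℕ+) (m : ℕ) {n : ℕ}
    {v : V} (h : v ∈ LinearMap.range (S.f il ^ n)) :
    (S.f il ^ m) v ∈ LinearMap.range (S.f il ^ (m + n)) := by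
  obtain ⟨v, rfl⟩ := h
  exact ⟨v, by rw [pow_add, Module.End.mul_apply]⟩

theorem pprod_succ (S : WeakLowerPerfectSpace k I P V) (seq : ℕ → I × ℕ+) (a : ℕ → ℕ) (m : ℕ) :
    S.pprod seq a (m + 1) =
      S.f (seq 0) ^ a 0 * S.pprod (fun j => seq (j + 1)) (fun j => a (j + 1)) m := by
  simp [pprod, List.range_succ_eq_map, Function.comp_def]

theorem Vgt_succ (S : WeakLowerPerfectSpace k I P V) (seq : ℕ → I × ℕ+) (a : ℕ → ℕ) (r : ℕ) :
    S.Vgt seq a (r + 1) = LinearMap.range (S.f (seq 0) ^ (a 0 + 1)) ⊔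
      (S.Vgt (fun j => seq (j + 1)) (fun j => a (j + 1)) r).map (S.f (seq 0) ^ a 0) := by
  have hstep : ∀ m : Fin r,
      LinearMap.range (S.pprod seq a ((m.succ : Fin (r + 1)) : ℕ) *
        S.f (seq ((m.succ : Fin (r + 1)) : ℕ)) ^ (a ((m.succ : Fin (r + 1)) : ℕ) + 1)) =
      (LinearMap.range (S.pprod (fun j => seq (j + 1)) (fun j => a (j + 1)) (m : ℕ) *
        S.f (seq ((m : ℕ) + 1)) ^ (a ((m : ℕ) + 1) + 1))).map (S.f (seq 0) ^ a 0) := by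
    intro m
    rw [Fin.val_succ, pprod_succ, mul_assoc, ← LinearMap.range_comp]
    rfl
  have hzero : LinearMap.range (S.pprod seq a ((0 : Fin (r + 1)) : ℕ) *
      S.f (seq ((0 : Fin (r + 1)) : ℕ)) ^ (a ((0 : Fin (r + 1)) : ℕ) + 1)) =
      LinearMap.range (S.f (seq 0) ^ (a 0 + 1)) := by
    simp [pprod]
  rw [Vgt, Vgt, Submodule.map_iSup]
  refine le_antisymm (iSup_le fun m => ?_) (sup_le ?_ (iSup_le fun m => ?_))
  · refine Fin.cases ?_ (fun m => ?_) m
    · rw [hzero]; exact le_sup_left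
    · rw [hstep]
      exact le_sup_of_le_right (le_iSup (fun m : Fin r =>
        (LinearMap.range (S.pprod (fun j => seq (j + 1)) (fun j => a (j + 1)) (m : ℕ) *
        S.f (seq ((m : ℕ) + 1)) ^ (a ((m : ℕ) + 1) + 1))).map (S.f (seq 0) ^ a 0)) m)
  · rw [← hzero]
    exact le_iSup (fun m : Fin (r + 1) => LinearMap.range (S.pprod seq a (m : ℕ) *
      S.f (seq (m : ℕ)) ^ (a (m : ℕ) + 1))) 0
  · rw [← hstep]
    exact le_iSup (fun m : Fin (r + 1) => LinearMap.range (S.pprod seq a (m : ℕ) *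
      S.f (seq (m : ℕ)) ^ (a (m : ℕ) + 1))) m.succ

/-- The string `d(i, b)` of `b` along `seq` equals `a`. -/
def HasString (S : WeakLowerPerfectSpace k I P V) (E : I × ℕ+ → V → V) (seq : ℕ → I × ℕ+)
    (a : ℕ → ℕ) (b : V) : Prop :=
  ∀ m : ℕ, S.d (seq m) (bseq E S.d seq b m) = a m

/-- The first `r` entries of the string of `b` along `seq` are lexicographically larger than
those of `a`. -/
def StringGt (S : WeakLowerPerfectSpace k I P V) (E : I × ℕ+ → V → V) :
    ℕ → (ℕ → I × ℕ+) → (ℕ → ℕ) → V → Prop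
  | 0, _, _, _ => False
  | r + 1, seq, a, b => a 0 < S.d (seq 0) b ∨ (S.d (seq 0) b = a 0 ∧
      StringGt S E r (fun j => seq (j + 1)) (fun j => a (j + 1)) ((E (seq 0))^[a 0] b))

theorem hasString_iff (S : WeakLowerPerfectSpace k I P V) (E : I × ℕ+ → V → V)
    (seq : ℕ → I × ℕ+) (a : ℕ → ℕ) (b : V) :
    S.HasString E seq a b ↔ S.d (seq 0) b = a 0 ∧
      S.HasString E (fun j => seq (j + 1)) (fun j => a (j + 1)) ((E (seq 0))^[a 0] b) := by
  constructor
  · intro h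
    have h0 : S.d (seq 0) b = a 0 := h 0
    refine ⟨h0, fun m => ?_⟩
    have := h (m + 1)
    rwa [bseq_succ, h0] at this
  · rintro ⟨h0, h⟩ m
    cases m with
    | zero => exact h0
    | succ m => rw [bseq_succ, h0]; exact h m

theorem HasString.not_stringGt {S : WeakLowerPerfectSpace k I P V} {E : I × ℕ+ → V → V} {r : ℕ} :
    ∀ {seq : ℕ → I × ℕ+} {a : ℕ → ℕ} {b : V}, S.HasString E seq a b →
      ¬ S.StringGt E r seq a b := by
  induction r with
  | zero => exact fun _ h => h
  | succ r ih =>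
    intro seq a b h
    obtain ⟨h0, h⟩ := (S.hasString_iff E seq a b).1 h
    rintro (hlt | ⟨-, hgt⟩)
    · omega
    · exact ih h hgt

theorem hasString_of_mem_highestCore {S : WeakLowerPerfectSpace k I P V} {B : Set V}
    (E : I × ℕ+ → V → V) (seq : ℕ → I × ℕ+) {a : ℕ → ℕ} (ha : ∀ m, a m = 0) {b : V}
    (hb : b ∈ S.highestCore B) : S.HasString E seq a b := by
  have h : ∀ m, bseq E S.d seq b m = b := by
    intro m
    induction m with
    | zero => rfl
    | succ m ih => rw [bseq, ih, hb.2, Function.iterate_zero, id]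
  intro m
  rw [h, hb.2, ha]

end WeakLowerPerfectSpace

namespace LowerPerfectBasis

open WeakLowerPerfectSpace

variable {k I P V : Type*} [Field k] [AddCommGroup P] [AddCommGroup V] [Module k V]
  {S : WeakLowerPerfectSpace k I P V} {B : Set V}

/-- The `k`-basis of `V` underlying a lower perfect basis. -/
noncomputable def basis (LB : LowerPerfectBasis S B) : Module.Basis B k V :=
  Module.Basis.mk LB.indep (by rw [Subtype.range_coe, LB.spans])

theorem basis_apply (LB : LowerPerfectBasis S B) (b : B) : LB.basis b = b := by
  simp [basis]

theorem ne_zero (LB : LowerPerfectBasis S B) {b : V} (hb : b ∈ B) : b ≠ 0 :=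
  LB.indep.ne_zero ⟨b, hb⟩

theorem coord_self (LB : LowerPerfectBasis S B) (b : B) : LB.basis.coord b b = 1 := by
  conv_lhs => rw [← LB.basis_apply b]
  simp

theorem coord_of_ne (LB : LowerPerfectBasis S B) (b : B) {x : V} (hx : x ∈ B ∪ {0})
    (h : x ≠ b) : LB.basis.coord b x = 0 := by
  rcases hx with hx | rfl
  · have : LB.basis ⟨x, hx⟩ = x := LB.basis_apply _
    rw [← this, Module.Basis.coord_apply, Module.Basis.repr_self]
    exact Finsupp.single_eq_of_ne' fun hxb => h (congrArg Subtype.val hxb)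
  · simp

theorem mem_span_of_coord (LB : LowerPerfectBasis S B) {T : Set V} {v : V}
    (h : ∀ b : B, (b : V) ∉ T → LB.basis.coord b v = 0) : v ∈ Submodule.span k T := by
  rw [← LB.basis.linearCombination_repr v]
  refine Submodule.sum_mem _ fun b hb => Submodule.smul_mem _ _ ?_
  rw [LB.basis_apply]
  refine Submodule.subset_span ?_
  by_contra hT
  exact Finsupp.mem_support_iff.1 hb (h b hT)

theorem coord_eq_zero_of_mem_span (LB : LowerPerfectBasis S B) {T : Set V} (hT : T ⊆ B ∪ {0})
    {b : B} (hb : (b : V) ∉ T) {v : V} (hv : v ∈ Submodule.span k T) :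
    LB.basis.coord b v = 0 := by
  have : Submodule.span k T ≤ LinearMap.ker (LB.basis.coord b) := by
    refine Submodule.span_le.2 fun x hx => LB.coord_of_ne b (hT hx) ?_
    rintro rfl
    exact hb hx
  exact this hv

theorem weight_le_span (LB : LowerPerfectBasis S B) (μ : P) :
    S.weight μ ≤ Submodule.span k (B ∩ S.weight μ) := by
  intro v hv
  have hle : Submodule.span k (B \ S.weight μ) ≤ ⨆ (ν) (_ : ν ≠ μ), S.weight ν := by
    refine Submodule.span_le.2 fun b hb => ?_
    obtain ⟨ν, hν⟩ := LB.graded b hb.1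
    have hne : ν ≠ μ := by
      rintro rfl
      exact hb.2 hν
    exact le_iSup₂ (f := fun ν (_ : ν ≠ μ) => S.weight ν) ν hne hν
  have hv' : v ∈ Submodule.span k (B ∩ S.weight μ) ⊔ Submodule.span k (B \ S.weight μ) := by
    rw [← Submodule.span_union, Set.inter_union_sdiff, LB.spans]
    trivial
  obtain ⟨x, hx, y, hy, rfl⟩ := Submodule.mem_sup.1 hv'
  have hxμ : x ∈ S.weight μ :=
    (Submodule.span_le.2 (fun _ h => h.2 : B ∩ S.weight μ ⊆ S.weight μ)) hx
  have hyμ : y ∈ S.weight μ := by simpa using (S.weight μ).sub_mem hv hxμ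
  have hy0 : y = 0 := Submodule.disjoint_def.1 (S.weight_indep μ) y hyμ (hle hy)
  simpa [hy0] using hx

theorem exists_coord_pow_eq_zero (LB : LowerPerfectBasis S B) (il : I × ℕ+) (b : B) :
    ∃ N, ∀ n ≥ N, ∀ v, LB.basis.coord b ((S.f il ^ n) v) = 0 := by
  obtain ⟨i, l⟩ := il
  obtain ⟨ν, hν⟩ := LB.graded b b.2
  obtain ⟨N, hN⟩ := Filter.eventually_atTop.1 (S.eventually_weight_eq_bot ν i l)
  refine ⟨N, fun n hn v => ?_⟩
  suffices h : LB.basis.coord b ∘ₗ (S.f (i, l) ^ n) = 0 from LinearMap.congr_fun h v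
  refine LB.basis.ext fun b' => ?_
  rw [LB.basis_apply, LinearMap.comp_apply, LinearMap.zero_apply]
  obtain ⟨μ, hμ⟩ := LB.graded b' b'.2
  have hmem := S.pow_mem_weight i l hμ n
  by_cases h : (b : V) ∈ S.weight (μ - (n * (l : ℕ)) • S.alpha i)
  · have hνμ : ν = μ - (n * (l : ℕ)) • S.alpha i := by
      by_contra hne
      exact LB.ne_zero b.2
        (Submodule.disjoint_def.1 (S.weight_indep.pairwiseDisjoint hne) b hν h)
    have hbot := hN n hn
    rw [hνμ, sub_add_cancel] at hbot
    rw [hbot, Submodule.mem_bot] at hμ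
    exact absurd hμ (LB.ne_zero b'.2)
  · exact LB.coord_eq_zero_of_mem_span (fun x hx => Or.inl hx.1) (fun hb => h hb.2)
      (LB.weight_le_span _ hmem)

theorem mem_range_pow_iff (LB : LowerPerfectBasis S B) (il : I × ℕ+) {v : V} (hv : v ≠ 0)
    (n : ℕ) : v ∈ LinearMap.range (S.f il ^ n) ↔ n ≤ S.d il v := by
  obtain ⟨b, hb⟩ : ∃ b, LB.basis.coord b v ≠ 0 := by
    by_contra! h
    exact hv (LB.basis.forall_coord_eq_zero_iff.1 h)
  obtain ⟨N, hN⟩ := LB.exists_coord_pow_eq_zero il b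
  have hbdd : BddAbove {n : ℕ | v ∈ LinearMap.range (S.f il ^ n)} := by
    refine ⟨N, ?_⟩
    rintro n ⟨w, rfl⟩
    by_contra hn
    exact hb (hN n (by omega) w)
  constructor
  · exact fun h => le_csSup hbdd h
  · have hmem : S.d il v ∈ {n : ℕ | v ∈ LinearMap.range (S.f il ^ n)} :=
      Nat.sSup_mem ⟨0, v, by simp⟩ hbdd
    exact fun h => S.range_pow_anti il h hmem

theorem iterate_F_zero (LB : LowerPerfectBasis S B) (il : I × ℕ+) (n : ℕ) :
    (LB.F il)^[n] 0 = 0 :=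
  Function.iterate_fixed (LB.F_zero il) n

theorem iterate_F_mem (LB : LowerPerfectBasis S B) (il : I × ℕ+) {b : V} (hb : b ∈ B ∪ {0})
    (n : ℕ) : (LB.F il)^[n] b ∈ B ∪ {0} := by
  induction n with
  | zero => exact hb
  | succ n ih =>
    rw [Function.iterate_succ_apply']
    rcases ih with h | h
    · exact LB.F_mem il _ h
    · rw [Set.mem_singleton_iff.1 h, LB.F_zero]
      exact Or.inr rfl

theorem iterate_F_mem_of_add (LB : LowerPerfectBasis S B) (il : I × ℕ+) {b : V}
    (hb : b ∈ B ∪ {0}) (m n : ℕ) (h : (LB.F il)^[m + n] b ∈ B) : (LB.F il)^[n] b ∈ B := by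
  rcases LB.iterate_F_mem il hb n with h' | h'
  · exact h'
  · rw [Function.iterate_add_apply, Set.mem_singleton_iff.1 h', iterate_F_zero] at h
    exact absurd rfl (LB.ne_zero h)

theorem F_mem_range_pow (LB : LowerPerfectBasis S B) (il : I × ℕ+) {b : V} (hb : b ∈ B) {n : ℕ}
    (h : n ≤ S.d il b) : LB.F il b ∈ LinearMap.range (S.f il ^ (n + 1)) := by
  obtain ⟨c, hc⟩ := LB.F_approx il b hb
  have h1 : S.f il b ∈ LinearMap.range (S.f il ^ (n + 1)) := by
    have := S.pow_mem_range_pow_add il 1 ((LB.mem_range_pow_iff il (LB.ne_zero hb) n).2 h)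
    rwa [pow_one, add_comm] at this
  have h2 := sub_mem h1 (S.range_pow_anti il (show n + 1 ≤ S.d il b + 2 by omega) hc)
  rw [sub_sub_cancel] at h2
  simpa using Submodule.smul_mem _ (↑c⁻¹ : k) h2

theorem iterate_F_mem_range_pow (LB : LowerPerfectBasis S B) (il : I × ℕ+) {b : V} (hb : b ∈ B)
    (n : ℕ) : (LB.F il)^[n] b ∈ LinearMap.range (S.f il ^ n) := by
  induction n with
  | zero => exact ⟨b, by simp⟩
  | succ n ih =>
    rw [Function.iterate_succ_apply']
    rcases LB.iterate_F_mem il (Or.inl hb) n with h | h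
    · exact LB.F_mem_range_pow il h ((LB.mem_range_pow_iff il (LB.ne_zero h) n).1 ih)
    · rw [Set.mem_singleton_iff.1 h, LB.F_zero]
      exact zero_mem _

theorem range_pow_le_sup (LB : LowerPerfectBasis S B) (il : I × ℕ+) (n : ℕ) :
    LinearMap.range (S.f il ^ n) ≤
      Submodule.span k ((LB.F il)^[n] '' B) ⊔ LinearMap.range (S.f il ^ (n + 1)) := by
  induction n with
  | zero => simp [LB.spans]
  | succ n ih =>
    have hmap : LinearMap.range (S.f il ^ (n + 1)) =
        (LinearMap.range (S.f il ^ n)).map (S.f il) := by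
      rw [pow_succ', ← LinearMap.range_comp]; rfl
    have hmap' : LinearMap.range (S.f il ^ (n + 2)) =
        (LinearMap.range (S.f il ^ (n + 1))).map (S.f il) := by
      rw [pow_succ', ← LinearMap.range_comp]; rfl
    rw [hmap]
    refine (Submodule.map_mono ih).trans ?_
    rw [Submodule.map_sup, ← hmap']
    refine sup_le ?_ le_sup_right
    rw [Submodule.map_span, Submodule.span_le]
    rintro _ ⟨_, ⟨b, hb, rfl⟩, rfl⟩
    rcases LB.iterate_F_mem il (Or.inl hb) n with h | h
    · obtain ⟨c, hc⟩ := LB.F_approx il _ h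
      have hd := (LB.mem_range_pow_iff il (LB.ne_zero h) n).1 (LB.iterate_F_mem_range_pow il hb n)
      rw [← add_sub_cancel ((c : k) • LB.F il ((LB.F il)^[n] b)) (S.f il ((LB.F il)^[n] b))]
      refine Submodule.add_mem_sup (Submodule.smul_mem _ _ (Submodule.subset_span ?_))
        (S.range_pow_anti il (by omega) hc)
      exact ⟨b, hb, Function.iterate_succ_apply' _ _ _⟩
    · rw [Set.mem_singleton_iff.1 h, map_zero]
      exact zero_mem _

theorem coord_pow_eq_zero (LB : LowerPerfectBasis S B) (il : I × ℕ+) (b : B) {n : ℕ}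
    (hb : (b : V) ∉ (LB.F il)^[n] '' B) (v : V) :
    LB.basis.coord b ((S.f il ^ n) v) = 0 := by
  obtain ⟨N, hN⟩ := LB.exists_coord_pow_eq_zero il b
  have key : ∀ j m, n ≤ m → N ≤ m + j →
      LinearMap.range (S.f il ^ m) ≤ LinearMap.ker (LB.basis.coord b) := by
    intro j
    induction j with
    | zero =>
      rintro m - hm _ ⟨w, rfl⟩
      exact hN m hm w
    | succ j ih =>
      intro m hnm hm
      refine (LB.range_pow_le_sup il m).trans (sup_le ?_ (ih (m + 1) (by omega) (by omega)))
      intro w hw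
      have hsub : (LB.F il)^[m] '' B ⊆ B ∪ {0} := by
        rintro _ ⟨x, hx, rfl⟩
        exact LB.iterate_F_mem il (Or.inl hx) m
      refine LB.coord_eq_zero_of_mem_span hsub ?_ hw
      rintro ⟨x, hx, hxb⟩
      have hmem : (LB.F il)^[n + (m - n)] x ∈ B := by
        rw [Nat.add_sub_of_le hnm, hxb]; exact b.2
      refine hb ⟨_, LB.iterate_F_mem_of_add il (Or.inl hx) n (m - n) hmem, ?_⟩
      rw [← Function.iterate_add_apply, Nat.add_sub_of_le hnm, hxb]
  exact key N n le_rfl (by omega) ⟨v, rfl⟩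

theorem le_d_iff (LB : LowerPerfectBasis S B) (il : I × ℕ+) {b : V} (hb : b ∈ B) (n : ℕ) :
    n ≤ S.d il b ↔ ∃ b' ∈ B, (LB.F il)^[n] b' = b := by
  rw [← LB.mem_range_pow_iff il (LB.ne_zero hb)]
  constructor
  · rintro ⟨v, hv⟩
    by_contra h
    have h0 := LB.coord_pow_eq_zero il ⟨b, hb⟩ (n := n) h v
    rw [hv, LB.coord_self ⟨b, hb⟩] at h0
    exact one_ne_zero h0
  · rintro ⟨b', hb', rfl⟩
    exact LB.iterate_F_mem_range_pow il hb' n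

theorem range_pow_le_span (LB : LowerPerfectBasis S B) (il : I × ℕ+) (n : ℕ) :
    LinearMap.range (S.f il ^ n) ≤ Submodule.span k {b | b ∈ B ∧ n ≤ S.d il b} := by
  rintro _ ⟨v, rfl⟩
  refine LB.mem_span_of_coord fun b hb => LB.coord_pow_eq_zero il b (fun h => hb ⟨b.2, ?_⟩) v
  exact (LB.le_d_iff il b.2 n).2 h

variable {E : I × ℕ+ → V → V}

theorem iterate_E_iterate_F (LB : LowerPerfectBasis S B)
    (hE : ∀ il : I × ℕ+, ∀ b ∈ B, ∀ b' ∈ B, LB.F il b' = b → E il b = b')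
    (il : I × ℕ+) {b : V} (hb : b ∈ B) {n : ℕ} (h : (LB.F il)^[n] b ∈ B) :
    (E il)^[n] ((LB.F il)^[n] b) = b := by
  induction n with
  | zero => rfl
  | succ n ih =>
    have h' : (LB.F il)^[n] b ∈ B :=
      LB.iterate_F_mem_of_add il (Or.inl hb) 1 n (by rwa [add_comm])
    rw [Function.iterate_succ_apply, hE il _ h _ h' (Function.iterate_succ_apply' _ _ _).symm,
      ih h']

theorem d_iterate_F (LB : LowerPerfectBasis S B)
    (hE : ∀ il : I × ℕ+, ∀ b ∈ B, ∀ b' ∈ B, LB.F il b' = b → E il b = b')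
    (il : I × ℕ+) {b : V} (hb : b ∈ B) {n : ℕ} (h : (LB.F il)^[n] b ∈ B) :
    S.d il ((LB.F il)^[n] b) = S.d il b + n := by
  apply le_antisymm
  · have hn : n ≤ S.d il ((LB.F il)^[n] b) := (LB.le_d_iff il h n).2 ⟨b, hb, rfl⟩
    obtain ⟨e, he⟩ := Nat.exists_eq_add_of_le hn
    obtain ⟨b', hb', hbb'⟩ := (LB.le_d_iff il h _).1 he.ge
    have hmem := LB.iterate_F_mem_of_add il (Or.inl hb') n e (by rwa [hbb'])
    have heq := LB.iterate_E_iterate_F hE il hmem (n := n)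
      (by rwa [← Function.iterate_add_apply, hbb'])
    rw [← Function.iterate_add_apply, hbb', LB.iterate_E_iterate_F hE il hb h] at heq
    have : e ≤ S.d il b := (LB.le_d_iff il hb e).2 ⟨b', hb', heq.symm⟩
    omega
  · obtain ⟨b', hb', hbb'⟩ := (LB.le_d_iff il hb _).1 le_rfl
    refine (LB.le_d_iff il h _).2 ⟨b', hb', ?_⟩
    rw [add_comm, Function.iterate_add_apply, hbb']

theorem pow_sub_iterate_F_mem (LB : LowerPerfectBasis S B)
    (hE : ∀ il : I × ℕ+, ∀ b ∈ B, ∀ b' ∈ B, LB.F il b' = b → E il b = b')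
    (il : I × ℕ+) {b : V} (hb : b ∈ B) (n : ℕ) :
    ∃ c : kˣ, (S.f il ^ n) b - (c : k) • (LB.F il)^[n] b ∈
      LinearMap.range (S.f il ^ (S.d il b + n + 1)) := by
  induction n with
  | zero => exact ⟨1, by simp⟩
  | succ n ih =>
    obtain ⟨c, hc⟩ := ih
    have hf := S.pow_mem_range_pow_add il 1 hc
    rw [pow_one, map_sub, map_smul, ← Module.End.mul_apply, ← pow_succ',
      show 1 + (S.d il b + n + 1) = S.d il b + (n + 1) + 1 by ring] at hf
    rw [Function.iterate_succ_apply']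
    rcases LB.iterate_F_mem il (Or.inl hb) n with h | h
    · obtain ⟨c', hc'⟩ := LB.F_approx il _ h
      rw [LB.d_iterate_F hE il hb h] at hc'
      refine ⟨c * c', ?_⟩
      convert add_mem hf (Submodule.smul_mem _ (c : k) hc') using 1
      rw [Units.val_mul, smul_sub, smul_smul]
      abel
    · rw [Set.mem_singleton_iff.1 h, map_zero, smul_zero] at hf
      rw [Set.mem_singleton_iff.1 h, LB.F_zero]
      exact ⟨1, by rwa [smul_zero]⟩

theorem iterate_E_spec (LB : LowerPerfectBasis S B)
    (hE : ∀ il : I × ℕ+, ∀ b ∈ B, ∀ b' ∈ B, LB.F il b' = b → E il b = b')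
    (il : I × ℕ+) {b : V} (hb : b ∈ B) :
    (E il)^[S.d il b] b ∈ B ∧ S.d il ((E il)^[S.d il b] b) = 0 ∧
      (LB.F il)^[S.d il b] ((E il)^[S.d il b] b) = b := by
  obtain ⟨b', hb', hbb'⟩ := (LB.le_d_iff il hb _).1 le_rfl
  have h : (LB.F il)^[S.d il b] b' ∈ B := by rwa [hbb']
  have hEb := LB.iterate_E_iterate_F hE il hb' h
  have hd := LB.d_iterate_F hE il hb' h
  rw [hbb'] at hEb hd
  rw [hEb]
  exact ⟨hb', by omega, hbb'⟩

theorem Vgt_le_span (LB : LowerPerfectBasis S B)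
    (hE : ∀ il : I × ℕ+, ∀ b ∈ B, ∀ b' ∈ B, LB.F il b' = b → E il b = b') (r : ℕ) :
    ∀ (seq : ℕ → I × ℕ+) (a : ℕ → ℕ),
      S.Vgt seq a r ≤ Submodule.span k {b | b ∈ B ∧ S.StringGt E r seq a b} := by
  induction r with
  | zero => intro seq a; simp [Vgt]
  | succ r ih =>
    intro seq a
    have hrange : LinearMap.range (S.f (seq 0) ^ (a 0 + 1)) ≤
        Submodule.span k {b | b ∈ B ∧ S.StringGt E (r + 1) seq a b} :=
      (LB.range_pow_le_span (seq 0) (a 0 + 1)).trans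
        (Submodule.span_mono fun b hb => ⟨hb.1, Or.inl hb.2⟩)
    rw [Vgt_succ]
    refine sup_le hrange ((Submodule.map_mono (ih _ _)).trans ?_)
    rw [Submodule.map_span, Submodule.span_le]
    rintro _ ⟨b, ⟨hb, hgt⟩, rfl⟩
    obtain ⟨c, hc⟩ := LB.pow_sub_iterate_F_mem hE (seq 0) hb (a 0)
    have hc' := hrange (S.range_pow_anti _ (by omega) hc)
    rw [SetLike.mem_coe, ← Submodule.sub_mem_iff_left _ (hy := Submodule.smul_mem _ (c : k) ?_)]
    · exact hc'
    rcases LB.iterate_F_mem (seq 0) (Or.inl hb) (a 0) with h | h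
    · refine Submodule.subset_span ⟨h, ?_⟩
      have hd := LB.d_iterate_F hE (seq 0) hb h
      rcases Nat.eq_zero_or_pos (S.d (seq 0) b) with h0 | h0
      · refine Or.inr ⟨by omega, ?_⟩
        rwa [LB.iterate_E_iterate_F hE (seq 0) hb h]
      · exact Or.inl (by omega)
    · rw [Set.mem_singleton_iff.1 h]
      exact zero_mem _

theorem notMem_Vgt_of_hasString (LB : LowerPerfectBasis S B)
    (hE : ∀ il : I × ℕ+, ∀ b ∈ B, ∀ b' ∈ B, LB.F il b' = b → E il b = b') (r : ℕ)
    {seq : ℕ → I × ℕ+} {a : ℕ → ℕ} {b : V} (hb : b ∈ B) (h : S.HasString E seq a b) :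
    b ∉ S.Vgt seq a r := by
  intro hmem
  have h0 := LB.coord_eq_zero_of_mem_span (b := ⟨b, hb⟩) (fun x hx => Or.inl hx.1)
    (fun hx => h.not_stringGt hx.2) (LB.Vgt_le_span hE r seq a hmem)
  rw [LB.coord_self ⟨b, hb⟩] at h0
  exact one_ne_zero h0

theorem bseq_mem (LB : LowerPerfectBasis S B)
    (hE : ∀ il : I × ℕ+, ∀ b ∈ B, ∀ b' ∈ B, LB.F il b' = b → E il b = b')
    (seq : ℕ → I × ℕ+) {b : V} (hb : b ∈ B) (m : ℕ) : bseq E S.d seq b m ∈ B := by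
  induction m with
  | zero => exact hb
  | succ m ih => exact (LB.iterate_E_spec hE _ ih).1

theorem bseq_mem_highestCore (LB : LowerPerfectBasis S B)
    (hE : ∀ il : I × ℕ+, ∀ b ∈ B, ∀ b' ∈ B, LB.F il b' = b → E il b = b')
    {seq : ℕ → I × ℕ+} (hseq : ∀ p : I × ℕ+, ∀ N : ℕ, ∃ m ≥ N, seq m = p)
    {a : ℕ → ℕ} {r : ℕ} (ha : ∀ m ≥ r, a m = 0) {b : V} (hb : b ∈ B)
    (h : S.HasString E seq a b) : bseq E S.d seq b r ∈ S.highestCore B := by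
  refine ⟨LB.bseq_mem hE seq hb r, fun il => ?_⟩
  have hconst : ∀ j, bseq E S.d seq b (r + j) = bseq E S.d seq b r := by
    intro j
    induction j with
    | zero => rfl
    | succ j ih =>
      rw [← add_assoc, bseq, h (r + j), ha (r + j) (by omega), Function.iterate_zero, id, ih]
  obtain ⟨m, hm, rfl⟩ := hseq il r
  obtain ⟨j, rfl⟩ := Nat.exists_eq_add_of_le hm
  rw [← hconst j, h (r + j), ha _ hm]

/-- An approximation at the tail of the sequence is transported by `f_{i_1 l_1}^{a_1}`. -/
theorem sub_smul_mem_Vgt_succ (LB : LowerPerfectBasis S B)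
    (hE : ∀ il : I × ℕ+, ∀ b ∈ B, ∀ b' ∈ B, LB.F il b' = b → E il b = b')
    (seq : ℕ → I × ℕ+) (a : ℕ → ℕ) (r : ℕ) {b w : V} (hb : b ∈ B) {c : k}
    (h : w - c • b ∈ S.Vgt (fun j => seq (j + 1)) (fun j => a (j + 1)) r) :
    ∃ c' : kˣ, (S.f (seq 0) ^ a 0) w - (c * c') • (LB.F (seq 0))^[a 0] b ∈
      S.Vgt seq a (r + 1) := by
  obtain ⟨c', hc'⟩ := LB.pow_sub_iterate_F_mem hE (seq 0) hb (a 0)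
  refine ⟨c', ?_⟩
  rw [Vgt_succ]
  have h1 := Submodule.mem_map_of_mem (f := S.f (seq 0) ^ a 0) h
  have h2 := Submodule.smul_mem _ c (S.range_pow_anti (seq 0)
    (show a 0 + 1 ≤ S.d (seq 0) b + a 0 + 1 by omega) hc')
  convert Submodule.add_mem_sup h2 h1 using 1
  rw [map_sub, map_smul, smul_sub, smul_smul]
  abel

theorem pprod_bseq_sub_smul_mem_Vgt (LB : LowerPerfectBasis S B)
    (hE : ∀ il : I × ℕ+, ∀ b ∈ B, ∀ b' ∈ B, LB.F il b' = b → E il b = b') (r : ℕ) :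
    ∀ {seq : ℕ → I × ℕ+} {a : ℕ → ℕ} {b : V}, b ∈ B → S.HasString E seq a b →
      ∃ c : kˣ, S.pprod seq a r (bseq E S.d seq b r) - (c : k) • b ∈ S.Vgt seq a r := by
  induction r with
  | zero => exact fun {seq a b} _ _ => ⟨1, by simp [pprod, bseq]⟩
  | succ r ih =>
    intro seq a b hb h
    obtain ⟨h0, h⟩ := (S.hasString_iff E seq a b).1 h
    obtain ⟨hmem, -, hF⟩ := LB.iterate_E_spec hE (seq 0) hb
    rw [h0] at hmem hF
    obtain ⟨c, hc⟩ := ih hmem h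
    obtain ⟨c', hc'⟩ := LB.sub_smul_mem_Vgt_succ hE seq a r hmem hc
    rw [hF] at hc'
    refine ⟨c * c', ?_⟩
    rwa [pprod_succ, bseq_succ, h0, Units.val_mul]

theorem exists_hasString_of_pprod_notMem (LB : LowerPerfectBasis S B)
    (hE : ∀ il : I × ℕ+, ∀ b ∈ B, ∀ b' ∈ B, LB.F il b' = b → E il b = b') {y : V}
    (hy : y ∈ S.highestCore B) (r : ℕ) :
    ∀ {seq : ℕ → I × ℕ+} {a : ℕ → ℕ}, (∀ m ≥ r, a m = 0) → S.pprod seq a r y ∉ S.Vgt seq a r →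
      ∃ b ∈ B, S.HasString E seq a b ∧
        ∃ c : kˣ, S.pprod seq a r y - (c : k) • b ∈ S.Vgt seq a r := by
  induction r with
  | zero =>
    intro seq a ha _
    exact ⟨y, hy.1, hasString_of_mem_highestCore E seq (fun m => ha m (Nat.zero_le m)) hy, 1,
      by simp [pprod]⟩
  | succ r ih =>
    intro seq a ha hne
    rw [pprod_succ, Module.End.mul_apply] at hne ⊢
    set w := S.pprod (fun j => seq (j + 1)) (fun j => a (j + 1)) r y
    obtain ⟨b, hb, hstr, c, hc⟩ := ih (seq := fun j => seq (j + 1)) (a := fun j => a (j + 1))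
      (fun m hm => ha (m + 1) (by omega)) fun hmem => hne (by
        rw [Vgt_succ]
        exact Submodule.mem_sup_right (Submodule.mem_map_of_mem hmem))
    obtain ⟨c', hc'⟩ := LB.sub_smul_mem_Vgt_succ hE seq a r hb hc
    have hF : (LB.F (seq 0))^[a 0] b ∉ S.Vgt seq a (r + 1) := fun hmem =>
      hne ((Submodule.sub_mem_iff_left _ (Submodule.smul_mem _ _ hmem)).1 hc')
    have hFB : (LB.F (seq 0))^[a 0] b ∈ B := by
      rcases LB.iterate_F_mem (seq 0) (Or.inl hb) (a 0) with h | h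
      · exact h
      · rw [Set.mem_singleton_iff.1 h] at hF
        exact absurd (zero_mem _) hF
    have hd := LB.d_iterate_F hE (seq 0) hb hFB
    have hd0 : S.d (seq 0) b = 0 := by
      by_contra h0
      refine hF ?_
      rw [Vgt_succ]
      exact Submodule.mem_sup_left
        ((LB.mem_range_pow_iff (seq 0) (LB.ne_zero hFB) _).2 (by omega))
    refine ⟨_, hFB, (S.hasString_iff E seq a _).2 ⟨by omega, ?_⟩, c * c', by
      rwa [Units.val_mul]⟩
    rwa [LB.iterate_E_iterate_F hE (seq 0) hb hFB]

end LowerPerfectBasis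

theorem stmt_11 {k I P V : Type*} [Field k] [AddCommGroup P] [AddCommGroup V] [Module k V]
    (S : WeakLowerPerfectSpace k I P V) (B : Set V) (LB : LowerPerfectBasis S B)
(E : I × ℕ+ → V → V)
    (hE0 : ∀ il : I × ℕ+, E il 0 = 0)
    (hEdef : ∀ il : I × ℕ+, ∀ b ∈ B, ∀ b' ∈ B, LB.F il b' = b → E il b = b')
    (hEnone : ∀ il : I × ℕ+, ∀ b ∈ B, (∀ b' ∈ B, LB.F il b' ≠ b) → E il b = 0)
    (seq : ℕ → I × ℕ+) (hseq : ∀ p : I × ℕ+, ∀ N : ℕ, ∃ m ≥ N, seq m = p)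
    (a : ℕ → ℕ) (r : ℕ) (ha : ∀ m ≥ r, a m = 0) :
    {x : V ⧸ S.Vgt seq a r | ∃ c : kˣ, ∃ y,
        (y ∈ B ∧ ∀ m : ℕ, S.d (seq m) (bseq E S.d seq y m) = a m) ∧
        x = (c : k) • (S.Vgt seq a r).mkQ y} =
    {x : V ⧸ S.Vgt seq a r | ∃ c : kˣ, ∃ y ∈ S.highestCore B,
        (S.Vgt seq a r).mkQ (S.pprod seq a r y) ≠ 0 ∧
        x = (c : k) • (S.Vgt seq a r).mkQ (S.pprod seq a r y)} := by
  have hmk : ∀ {u v : V} {c : k}, u - c • v ∈ S.Vgt seq a r →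
      (S.Vgt seq a r).mkQ u = c • (S.Vgt seq a r).mkQ v := fun {u v c} h => by
    rw [← map_smul]
    exact (Submodule.Quotient.eq _).2 h
  ext x
  constructor
  · rintro ⟨c, y, ⟨hy, hstr⟩, rfl⟩
    obtain ⟨c', hc'⟩ := LB.pprod_bseq_sub_smul_mem_Vgt hEdef r hy hstr
    have hy0 : (S.Vgt seq a r).mkQ y ≠ 0 := fun h =>
      LB.notMem_Vgt_of_hasString hEdef r hy hstr ((Submodule.Quotient.mk_eq_zero _).1 h)
    refine ⟨c * c'⁻¹, _, LB.bseq_mem_highestCore hEdef hseq ha hy hstr, ?_, ?_⟩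
    · rw [hmk hc']
      exact smul_ne_zero c'.ne_zero hy0
    · rw [hmk hc', smul_smul, Units.val_mul, mul_assoc, Units.inv_mul, mul_one]
  · rintro ⟨c, y, hy, hne, rfl⟩
    obtain ⟨b, hb, hstr, c', hc'⟩ := LB.exists_hasString_of_pprod_notMem hEdef hy r ha
      fun h => hne ((Submodule.Quotient.mk_eq_zero _).2 h)
    exact ⟨c * c', b, ⟨hb, hstr⟩, by rw [hmk hc', smul_smul, Units.val_mul]⟩
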